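/- Let (C, D, E, i_*, j^*, i^*, i^!, j_!, j_*) be gluing data endowed with compatible t-structures t_C, t_D, t_E. If X' ∈ E^{t_E=0} is a simple object of the heart of t_E, then j_{!*}X' is a simple object of the heart of t_C. -/

import Mathlib

namespace PaperGluing

open CategoryTheory CategoryTheory.Limits CategoryTheory.Pretriangulated CategoryTheory.Triangulated

universe v v₂ v₃ v₄ u u₂ u₃ u₄

section Generic

variable (A : Type u₄) [Category.{v₄} A] [HasZeroObject A] [Preadditive A] [HasShift A ℤ]
  [∀ n : ℤ, (shiftFunctor A n).Additive] [Pretriangulated A]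

/-- The class `A^{t=0}` of a `t`-structure. -/
def heartSet (t : TStructure A) : Set A := fun X => t.le 0 X ∧ t.ge 0 X

/-- The heart of a `t`-structure, as a full subcategory. -/
abbrev THeart (t : TStructure A) := ObjectProperty.FullSubcategory (fun X => X ∈ heartSet A t)

/-- The inclusion of the heart. -/
abbrev heartIncl (t : TStructure A) : THeart A t ⥤ A :=
  ObjectProperty.ι (fun X => X ∈ heartSet A t)

/-- Truncation data for a `t`-structure `t` (such data always exists):
functors `τ_{≤0}`, `τ_{≥0}` with their universal properties. -/
structure TruncData (t : TStructure A) where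
  truncLE : A ⥤ A
  truncGE : A ⥤ A
  εLE : truncLE ⟶ 𝟭 A
  ηGE : 𝟭 A ⟶ truncGE
  mem_le : ∀ X : A, t.le 0 (truncLE.obj X)
  mem_ge : ∀ X : A, t.ge 0 (truncGE.obj X)
  le_univ : ∀ (W X : A), t.le 0 W →
    Function.Bijective (fun f : W ⟶ truncLE.obj X => f ≫ εLE.app X)
  ge_univ : ∀ (X W : A), t.ge 0 W →
    Function.Bijective (fun f : truncGE.obj X ⟶ W => ηGE.app X ≫ f)
  mem_heart : ∀ X : A, truncGE.obj (truncLE.obj X) ∈ heartSet A t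
  isoHeart : ∀ X : A, X ∈ heartSet A t → (truncGE.obj (truncLE.obj X) ≅ X)

variable {A}

/-- The zeroth homology functor `H^t_0 : A ⥤ Ht`. -/
def TruncData.H₀ {t : TStructure A} (τ : TruncData A t) : A ⥤ THeart A t :=
  ObjectProperty.lift _ (τ.truncLE ⋙ τ.truncGE) (fun X => τ.mem_heart X)

end Generic

variable {C : Type u} {D : Type u₂} {E : Type u₃}
  [Category.{v} C] [Category.{v₂} D] [Category.{v₃} E]
  [HasZeroObject C] [HasZeroObject D] [HasZeroObject E]
  [Preadditive C] [Preadditive D] [Preadditive E]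
  [HasShift C ℤ] [HasShift D ℤ] [HasShift E ℤ]
  [∀ n : ℤ, (shiftFunctor C n).Additive] [∀ n : ℤ, (shiftFunctor D n).Additive]
  [∀ n : ℤ, (shiftFunctor E n).Additive]
  [Pretriangulated C] [Pretriangulated D] [Pretriangulated E]

/-- The conditions, beyond the exactness of the six functors and the four
adjunctions, making `(C, D, E, i_*, j^*, i^*, i^!, j_!, j_*)` into gluing data:
`i_*` is a full embedding, `j^*` is the localization of `C` by `i_*(D)` (its
kernel is the essential image of `i_*`), the two adjunction triangles are
distinguished, `i^* j_! = 0`, `i^! j_* = 0`, and the four adjunction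
transformations `i^* i_* → id → i^! i_*`, `j^* j_* → id → j^* j_!` are
isomorphisms. -/
structure GluingCond (iS : D ⥤ C) (jU : C ⥤ E) (iU iE : C ⥤ D) (jL jR : E ⥤ C)
    (adj₁ : iU ⊣ iS) (adj₂ : iS ⊣ iE) (adj₃ : jL ⊣ jU) (adj₄ : jU ⊣ jR) :
    Prop where
  full_iS : iS.Full
  faithful_iS : iS.Faithful
  ker_jU : ∀ X : C, IsZero (jU.obj X) ↔ ∃ Y : D, Nonempty (iS.obj Y ≅ X)
  tri₁ : ∀ X : C, ∃ δ : iS.obj (iU.obj X) ⟶ (jL.obj (jU.obj X))⟦(1 : ℤ)⟧,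
    Triangle.mk (adj₃.counit.app X) (adj₁.unit.app X) δ ∈ distTriang C
  tri₂ : ∀ X : C, ∃ δ : jR.obj (jU.obj X) ⟶ (iS.obj (iE.obj X))⟦(1 : ℤ)⟧,
    Triangle.mk (adj₂.counit.app X) (adj₄.unit.app X) δ ∈ distTriang C
  vanish₁ : ∀ Y : E, IsZero (iU.obj (jL.obj Y))
  vanish₂ : ∀ Y : E, IsZero (iE.obj (jR.obj Y))
  iso₁ : ∀ Y : D, IsIso (adj₁.counit.app Y)
  iso₂ : ∀ Y : D, IsIso (adj₂.unit.app Y)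
  iso₃ : ∀ X : E, IsIso (adj₃.unit.app X)
  iso₄ : ∀ X : E, IsIso (adj₄.counit.app X)

/-- The `t`-structure `tC` is glued from `tD` and `tE` (the three t-structures
are then called compatible). -/
def GluedTS (jU : C ⥤ E) (iU iE : C ⥤ D)
    (tC : TStructure C) (tD : TStructure D) (tE : TStructure E) : Prop :=
  ∀ X : C, (tC.le 0 X ↔ (tE.le 0 (jU.obj X) ∧ tD.le 0 (iU.obj X))) ∧
    (tC.ge 0 X ↔ (tE.ge 0 (jU.obj X) ∧ tD.ge 0 (iE.obj X)))

/-- The intermediate image `j_{!*}X'` of an object `X'` of the heart of `tE`: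
the image of `H^{t_C}_0(j_! X') ⟶ H^{t_C}_0(j_* X')`, where the morphism
`j_! X' ⟶ j_* X'` is obtained from the adjunctions via `j^* j_! ≅ id ≅ j^* j_*`. -/
noncomputable def jMiddle (jU : C ⥤ E) (jL jR : E ⥤ C)
    (adj₃ : jL ⊣ jU) (adj₄ : jU ⊣ jR)
    (hiso : ∀ Y : E, IsIso (adj₃.unit.app Y))
    {tC : TStructure C} (τC : TruncData C tC) [HasImages (THeart C tC)]
    {tE : TStructure E} (X' : THeart E tE) : THeart C tC :=
  haveI := hiso X'.obj
  image (τC.H₀.map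
    ((adj₄.homEquiv (jL.obj X'.obj) X'.obj) (inv (adj₃.unit.app X'.obj))))


section Helpers

universe w₁ w₂ w₃ w₄

variable {A : Type w₁} [Category.{w₂} A] [HasZeroObject A] [Preadditive A] [HasShift A ℤ]
  [∀ n : ℤ, (shiftFunctor A n).Additive] [Pretriangulated A]
variable {B : Type w₃} [Category.{w₄} B] [HasZeroObject B] [Preadditive B] [HasShift B ℤ]
  [∀ n : ℤ, (shiftFunctor B n).Additive] [Pretriangulated B]

lemma aux_isLE {t : TStructure A} (X : THeart A t) : t.IsLE X.obj 0 := ⟨X.property.1⟩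

lemma aux_isGE {t : TStructure A} (X : THeart A t) : t.IsGE X.obj 0 := ⟨X.property.2⟩

/-- The cone of a monomorphism of the heart is `≥ 0`. -/
lemma aux_cone_ge {t : TStructure A} {X Y : THeart A t} (f : X ⟶ Y) [Mono f]
    {Z : A} (g : Y.obj ⟶ Z) (h : Z ⟶ X.obj⟦(1 : ℤ)⟧)
    (hT : Triangle.mk f.hom g h ∈ distTriang A) : t.IsGE Z 0 := by
  have := aux_isGE X
  have := aux_isGE Y
  have hX1 : t.IsGE (X.obj⟦(1 : ℤ)⟧) (-1) := t.isGE_shift X.obj 0 1 (-1)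
  have hY1 : t.IsGE Y.obj (-1) := t.isGE_of_ge Y.obj (-1) 0
  have hZ : t.IsGE Z (-1) :=
    t.isGE₂ _ (rot_of_distTriang _ hT) (-1) hY1 hX1
  rw [t.isGE_iff_isZero_truncLT_obj]
  let W := (t.truncLT 0).obj Z
  have hWle : t.IsLE W (-1) := t.isLE_truncLT_obj Z 0 (-1)
  have hWge : t.IsGE W (-1) := by
    refine t.isGE₂ _ (inv_rot_of_distTriang _ (t.triangleLTGE_distinguished 0 Z)) (-1) ?_ hZ
    have : t.IsGE ((t.truncGE 0).obj Z) 0 := inferInstance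
    have h1 : t.IsGE (((t.truncGE 0).obj Z)⟦(-1 : ℤ)⟧) 1 := t.isGE_shift _ 0 (-1) 1
    exact t.isGE_of_ge (((t.truncGE 0).obj Z)⟦(-1 : ℤ)⟧) (-1) 1
  let V : THeart A t := ⟨W⟦(-1 : ℤ)⟧,
    (t.isLE_shift W (-1) (-1) 0).le, (t.isGE_shift W (-1) (-1) 0).ge⟩
  let e : V.obj⟦(1 : ℤ)⟧ ≅ W := (shiftEquiv A (1 : ℤ)).counitIso.app W
  let p : W ⟶ Z := (t.truncLTι 0).app Z
  have hp : p ≫ h = 0 := by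
    obtain ⟨u, hu⟩ := (shiftFunctor A (1 : ℤ)).map_surjective (e.hom ≫ p ≫ h)
    have h31 : h ≫ f.hom⟦(1 : ℤ)⟧' = 0 := comp_distTriang_mor_zero₃₁ _ hT
    have huf : u ≫ f.hom = 0 := by
      apply (shiftFunctor A (1 : ℤ)).map_injective
      rw [Functor.map_comp, hu, Functor.map_zero]
      simp [h31]
    have hu0 : (ObjectProperty.homMk u : V ⟶ X) = ObjectProperty.homMk 0 := by
      rw [← cancel_mono f]
      ext
      simpa using huf
    have hu1 : u = 0 := congrArg (fun q => q.hom) hu0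
    rw [← cancel_epi e.hom, ← hu, hu1]
    simp
  obtain ⟨q, hq⟩ := Triangle.coyoneda_exact₃ _ hT p hp
  have hq0 : q = 0 := t.zero_of_isLE_of_isGE q (-1) 0 (by lia) hWle (aux_isGE Y)
  have hp0 : p = 0 := by
    subst hq0
    exact hq.trans zero_comp
  rw [IsZero.iff_id_eq_zero]
  apply t.to_truncLT_obj_ext
  change 𝟙 _ ≫ p = 0 ≫ p
  rw [hp0]; simp

/-- A morphism whose cone is `≥ 0` is left cancellable on `≤ 0` objects. -/
lemma aux_cancel {t : TStructure A} {X Y Z W : A} (f : X ⟶ Y) (g : Y ⟶ Z)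
    (h : Z ⟶ X⟦(1 : ℤ)⟧) (hT : Triangle.mk f g h ∈ distTriang A) (hZ : t.IsGE Z 0)
    (hW : t.IsLE W 0) (u : W ⟶ X) (hu : u ≫ f = 0) : u = 0 := by
  obtain ⟨v, hv⟩ := Triangle.coyoneda_exact₂ _ (inv_rot_of_distTriang _ hT) u hu
  have hv0 : v = 0 :=
    t.zero_of_isLE_of_isGE v 0 1 (by lia) hW (t.isGE_shift Z 0 (-1) 1)
  subst hv0
  exact hv.trans zero_comp

lemma aux_F_ge {t : TStructure A} {t' : TStructure B} (F : A ⥤ B) [F.CommShift ℤ]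
    (hF : ∀ X, t.ge 0 X → t'.ge 0 (F.obj X)) (n : ℤ) (X : A) (hX : t.IsGE X n) :
    t'.IsGE (F.obj X) n := by
  have h1 : t'.IsGE (F.obj (X⟦n⟧)) 0 := ⟨hF _ (t.isGE_shift X n n 0).ge⟩
  have h2 : t'.IsGE ((F.obj X)⟦n⟧) 0 :=
    t'.isGE_of_iso (show F.obj (X⟦n⟧) ≅ (F.obj X)⟦n⟧ from (F.commShiftIso n).app X) 0
  exact t'.isGE_of_shift _ n n 0

lemma aux_F_le {t : TStructure A} {t' : TStructure B} (F : A ⥤ B) [F.CommShift ℤ]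
    (hF : ∀ X, t.le 0 X → t'.le 0 (F.obj X)) (n : ℤ) (X : A) (hX : t.IsLE X n) :
    t'.IsLE (F.obj X) n := by
  have h1 : t'.IsLE (F.obj (X⟦n⟧)) 0 := ⟨hF _ (t.isLE_shift X n n 0).le⟩
  have h2 : t'.IsLE ((F.obj X)⟦n⟧) 0 :=
    t'.isLE_of_iso (show F.obj (X⟦n⟧) ≅ (F.obj X)⟦n⟧ from (F.commShiftIso n).app X) 0
  exact t'.isLE_of_shift _ n n 0

/-- The cone of the image of a monomorphism under a t-exact functor. -/
lemma aux_map_mono {t : TStructure A} {t' : TStructure B} (F : A ⥤ B) [F.CommShift ℤ]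
    [F.IsTriangulated] (hF : ∀ X, t.ge 0 X → t'.ge 0 (F.obj X))
    {X Y : THeart A t} (f : X ⟶ Y) [Mono f] {W : B} (hW : t'.IsLE W 0)
    (u : W ⟶ F.obj X.obj) (hu : u ≫ F.map f.hom = 0) : u = 0 := by
  obtain ⟨Z, g, h, hT⟩ := distinguished_cocone_triangle f.hom
  have hZ := aux_F_ge F hF 0 Z (aux_cone_ge f g h hT)
  exact aux_cancel (t := t') _ _ _ (F.map_distinguished _ hT) hZ hW u hu

lemma aux_iso_le {t : TStructure A} (τ : TruncData A t) (X : A) :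
    ∃ i : (t.truncLT 1).obj X ⟶ τ.truncLE.obj X, IsIso i ∧
      i ≫ τ.εLE.app X = (t.truncLTι 1).app X := by
  have h1 : t.IsLE ((t.truncLT 1).obj X) 0 := t.isLE_truncLT_obj X 1 0
  have h2 : t.IsLE (τ.truncLE.obj X) 0 := ⟨τ.mem_le X⟩
  obtain ⟨i, hi⟩ := (τ.le_univ _ X h1.le).2 ((t.truncLTι 1).app X)
  dsimp at hi
  let k : τ.truncLE.obj X ⟶ (t.truncLT 1).obj X := t.liftTruncLT (τ.εLE.app X) 0 1 (by lia)
  have hk : k ≫ (t.truncLTι 1).app X = τ.εLE.app X := t.liftTruncLT_ι _ 0 1 (by lia)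
  refine ⟨i, ⟨k, ?_, ?_⟩, hi⟩
  · have : t.IsLE ((t.truncLT 1).obj X) (1 - 1) := inferInstance
    apply t.to_truncLT_obj_ext
    simp [hk, hi]
  · apply (τ.le_univ _ X h2.le).1
    simp [hk, hi]

lemma aux_iso_ge {t : TStructure A} (τ : TruncData A t) (X : A) :
    ∃ i : τ.truncGE.obj X ⟶ (t.truncGE 0).obj X, IsIso i ∧
      τ.ηGE.app X ≫ i = (t.truncGEπ 0).app X := by
  have h1 : t.IsGE ((t.truncGE 0).obj X) 0 := inferInstance
  have h2 : t.IsGE (τ.truncGE.obj X) 0 := ⟨τ.mem_ge X⟩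
  obtain ⟨i, hi⟩ := (τ.ge_univ X _ h1.ge).2 ((t.truncGEπ 0).app X)
  dsimp at hi
  let k : (t.truncGE 0).obj X ⟶ τ.truncGE.obj X := t.descTruncGE (τ.ηGE.app X) 0
  have hk : (t.truncGEπ 0).app X ≫ k = τ.ηGE.app X := t.π_descTruncGE _ 0
  refine ⟨i, ⟨k, ?_, ?_⟩, hi⟩
  · apply (τ.ge_univ X _ h2.ge).1
    simp [hk, reassoc_of% hi]
  · apply t.from_truncGE_obj_ext
    simp [hi, reassoc_of% hk]

lemma aux_F_ε {t : TStructure A} {t' : TStructure B} (F : A ⥤ B) [F.CommShift ℤ]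
    [F.IsTriangulated] (hF : ∀ X, t.ge 0 X → t'.ge 0 (F.obj X))
    (hF' : ∀ X, t.le 0 X → t'.le 0 (F.obj X))
    (τ : TruncData A t) (X : A) (hX : t'.IsLE (F.obj X) 0) :
    IsIso (F.map (τ.εLE.app X)) := by
  obtain ⟨i, hi, hi'⟩ := aux_iso_le τ X
  have hT := F.map_distinguished _ (t.triangleLTGE_distinguished 1 X)
  have h1 : t'.IsLE (F.obj ((t.truncLT 1).obj X)) 0 :=
    aux_F_le F hF' 0 _ (t.isLE_truncLT_obj X 1 0)
  have h3 : t'.IsGE (F.obj ((t.truncGE 1).obj X)) 1 := aux_F_ge F hF 1 _ inferInstance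
  have h1' : t'.IsLE ((F.obj ((t.truncLT 1).obj X))⟦(1 : ℤ)⟧) (-1) := t'.isLE_shift _ 0 1 (-1)
  have h3' : t'.IsLE (F.obj ((t.truncGE 1).obj X)) 0 :=
    t'.isLE₂ _ (rot_of_distTriang _ hT) 0 hX
      (t'.isLE_of_le ((F.obj ((t.truncLT 1).obj X))⟦(1 : ℤ)⟧) (-1) 0)
  have h0 : IsZero (F.obj ((t.truncGE 1).obj X)) := t'.isZero _ 0 1
  have : IsIso (F.map ((t.truncLTι 1).app X)) := (Triangle.isZero₃_iff_isIso₁ _ hT).1 h0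
  rw [← hi', F.map_comp] at this
  exact IsIso.of_isIso_comp_left (F.map i) _

lemma aux_F_η {t : TStructure A} {t' : TStructure B} (F : A ⥤ B) [F.CommShift ℤ]
    [F.IsTriangulated] (hF : ∀ X, t.ge 0 X → t'.ge 0 (F.obj X))
    (hF' : ∀ X, t.le 0 X → t'.le 0 (F.obj X))
    (τ : TruncData A t) (X : A) (hX : t'.IsGE (F.obj X) 0) :
    IsIso (F.map (τ.ηGE.app X)) := by
  obtain ⟨i, hi, hi'⟩ := aux_iso_ge τ X
  have hT := F.map_distinguished _ (t.triangleLTGE_distinguished 0 X)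
  have h1 : t'.IsLE (F.obj ((t.truncLT 0).obj X)) (-1) :=
    aux_F_le F hF' (-1) _ (t.isLE_truncLT_obj X 0 (-1))
  have h3 : t'.IsGE (F.obj ((t.truncGE 0).obj X)) 0 := aux_F_ge F hF 0 _ inferInstance
  have h1' : t'.IsGE (F.obj ((t.truncLT 0).obj X)) 0 := by
    refine t'.isGE₂ _ (inv_rot_of_distTriang _ hT) 0 ?_ hX
    have : t'.IsGE ((F.obj ((t.truncGE 0).obj X))⟦(-1 : ℤ)⟧) 1 := t'.isGE_shift _ 0 (-1) 1
    exact t'.isGE_of_ge ((F.obj ((t.truncGE 0).obj X))⟦(-1 : ℤ)⟧) 0 1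
  have h0 : IsZero (F.obj ((t.truncLT 0).obj X)) := t'.isZero _ (-1) 0
  have : IsIso (F.map ((t.truncGEπ 0).app X)) := (Triangle.isZero₁_iff_isIso₂ _ hT).1 h0
  rw [← hi', F.map_comp] at this
  exact IsIso.of_isIso_comp_right _ (F.map i)

end Helpers

/-- Given gluing data endowed with compatible t-structures,
if `X'` is a simple object of the heart of `t_E`, then `j_{!*}X'` is a simple
object of the heart of `t_C`. -/
theorem statement19
    (iS : D ⥤ C) (jU : C ⥤ E) (iU iE : C ⥤ D) (jL jR : E ⥤ C)
    [iS.CommShift ℤ] [jU.CommShift ℤ] [iU.CommShift ℤ] [iE.CommShift ℤ]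
    [jL.CommShift ℤ] [jR.CommShift ℤ]
    [iS.IsTriangulated] [jU.IsTriangulated] [iU.IsTriangulated]
    [iE.IsTriangulated] [jL.IsTriangulated] [jR.IsTriangulated]
    (adj₁ : iU ⊣ iS) (adj₂ : iS ⊣ iE) (adj₃ : jL ⊣ jU) (adj₄ : jU ⊣ jR)
    (hg : GluingCond iS jU iU iE jL jR adj₁ adj₂ adj₃ adj₄)
    (tC : TStructure C) (tD : TStructure D) (tE : TStructure E)
    (hglued : GluedTS jU iU iE tC tD tE)
    (τC : TruncData C tC) [HasImages (THeart C tC)]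
    (X' : THeart E tE) (hX' : Simple X') :
    Simple (jMiddle jU jL jR adj₃ adj₄ hg.iso₃ τC X') := by
  have hge : ∀ X, tC.ge 0 X → tE.ge 0 (jU.obj X) := fun X hX => ((hglued X).2.1 hX).1
  have hle : ∀ X, tC.le 0 X → tE.le 0 (jU.obj X) := fun X hX => ((hglued X).1.1 hX).1
  have hi3 := hg.iso₃ X'.obj
  have hi4 := hg.iso₄ X'.obj
  have eL : X'.obj ≅ jU.obj (jL.obj X'.obj) := asIso (adj₃.unit.app X'.obj)
  have eR : jU.obj (jR.obj X'.obj) ≅ X'.obj := asIso (adj₄.counit.app X'.obj)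
  have hX'le := aux_isLE X'
  have hX'ge := aux_isGE X'
  have hjLle : tC.IsLE (jL.obj X'.obj) 0 :=
    ⟨(hglued _).1.2 ⟨(tE.isLE_of_iso eL 0).le, (tD.isLE_of_isZero (hg.vanish₁ _) 0).le⟩⟩
  have hjRge : tC.IsGE (jR.obj X'.obj) 0 :=
    ⟨(hglued _).2.2 ⟨(tE.isGE_of_iso eR.symm 0).ge, (tD.isGE_of_isZero (hg.vanish₂ _) 0).ge⟩⟩
  let φ : jL.obj X'.obj ⟶ jR.obj X'.obj :=
    (adj₄.homEquiv (jL.obj X'.obj) X'.obj) (inv (adj₃.unit.app X'.obj))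
  have hφ : IsIso (jU.map φ) := by
    have h1 : jU.map φ ≫ adj₄.counit.app X'.obj = inv (adj₃.unit.app X'.obj) := by
      refine (adj₄.homEquiv_counit (g := φ)).symm.trans ?_
      exact Equiv.symm_apply_apply _ _
    have h2 : IsIso (jU.map φ ≫ adj₄.counit.app X'.obj) := by rw [h1]; infer_instance
    exact IsIso.of_isIso_comp_right _ (adj₄.counit.app X'.obj)
  let ψ := τC.H₀.map φ
  change Simple (image ψ)
  let e := factorThruImage ψ
  let m := image.ι ψ
  have hem : e ≫ m = ψ := image.fac ψ
  -- the truncations of `j_! X'` and `j_* X'` are well behaved after applying `j^*`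
  have hLE : ∀ X : C, tE.IsLE (jU.obj X) 0 → IsIso (jU.map (τC.εLE.app X)) :=
    fun X hX => aux_F_ε jU hge hle τC X hX
  have hGE : ∀ X : C, tE.IsGE (jU.obj X) 0 → IsIso (jU.map (τC.ηGE.app X)) :=
    fun X hX => aux_F_η jU hge hle τC X hX
  have ε1 := hLE (jL.obj X'.obj) (tE.isLE_of_iso eL 0)
  have ε2 := hLE (jR.obj X'.obj) (tE.isLE_of_iso eR.symm 0)
  have η1 := hGE (τC.truncLE.obj (jL.obj X'.obj))
    (tE.isGE_of_iso (eL ≪≫ (asIso (jU.map (τC.εLE.app (jL.obj X'.obj)))).symm) 0)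
  have η2 := hGE (τC.truncLE.obj (jR.obj X'.obj))
    (tE.isGE_of_iso (eR.symm ≪≫ (asIso (jU.map (τC.εLE.app (jR.obj X'.obj)))).symm) 0)
  have hψ1 : IsIso (jU.map (τC.truncLE.map φ)) := by
    have hn : jU.map (τC.truncLE.map φ) ≫ jU.map (τC.εLE.app (jR.obj X'.obj)) =
        jU.map (τC.εLE.app (jL.obj X'.obj)) ≫ jU.map φ := by
      rw [← jU.map_comp, ← jU.map_comp, τC.εLE.naturality]; rfl
    have : IsIso (jU.map (τC.truncLE.map φ) ≫ jU.map (τC.εLE.app (jR.obj X'.obj))) := by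
      rw [hn]; exact IsIso.comp_isIso' ε1 hφ
    exact IsIso.of_isIso_comp_right _ (jU.map (τC.εLE.app (jR.obj X'.obj)))
  have hψ : IsIso (jU.map ψ.hom) := by
    let w : τC.truncGE.obj (τC.truncLE.obj (jL.obj X'.obj)) ⟶
      τC.truncGE.obj (τC.truncLE.obj (jR.obj X'.obj)) := τC.truncGE.map (τC.truncLE.map φ)
    change IsIso (jU.map w)
    have hn : jU.map (τC.ηGE.app (τC.truncLE.obj (jL.obj X'.obj))) ≫ jU.map w =
        jU.map (τC.truncLE.map φ) ≫ jU.map (τC.ηGE.app (τC.truncLE.obj (jR.obj X'.obj))) := by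
      have h := τC.ηGE.naturality (τC.truncLE.map φ)
      have h' := congrArg jU.map h
      rw [jU.map_comp, jU.map_comp] at h'
      exact h'.symm
    have h1 : IsIso (jU.map (τC.truncLE.map φ) ≫
        jU.map (τC.ηGE.app (τC.truncLE.obj (jR.obj X'.obj)))) := IsIso.comp_isIso' hψ1 η2
    have : IsIso (jU.map (τC.ηGE.app (τC.truncLE.obj (jL.obj X'.obj))) ≫ jU.map w) := by
      rw [hn]; exact h1
    exact IsIso.of_isIso_comp_left (jU.map (τC.ηGE.app (τC.truncLE.obj (jL.obj X'.obj)))) _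
  have hKle : tE.IsLE (jU.obj (image ψ).obj) 0 := ⟨hle _ (image ψ).property.1⟩
  have hm : IsIso (jU.map m.hom) := by
    have hc : jU.map e.hom ≫ jU.map m.hom = jU.map ψ.hom := by
      rw [← jU.map_comp]
      exact congrArg (fun q => jU.map q.hom) hem
    have hs : (inv (jU.map ψ.hom) ≫ jU.map e.hom) ≫ jU.map m.hom = 𝟙 _ := by
      rw [Category.assoc, hc, IsIso.inv_hom_id]
    refine ⟨inv (jU.map ψ.hom) ≫ jU.map e.hom, ?_, hs⟩
    rw [← sub_eq_zero]
    apply aux_map_mono jU hge m hKle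
    rw [Preadditive.sub_comp, Category.assoc, hs]
    simp
  -- `j^* j_{!*} X' ≅ X'`
  let eK : jU.obj (image ψ).obj ≅ X'.obj :=
    (asIso (jU.map m.hom) : jU.obj (image ψ).obj ≅ jU.obj (τC.H₀.obj (jR.obj X'.obj)).obj) ≪≫
      (show jU.obj (τC.H₀.obj (jR.obj X'.obj)).obj ≅ jU.obj (τC.truncLE.obj (jR.obj X'.obj)) from
        (asIso (jU.map (τC.ηGE.app (τC.truncLE.obj (jR.obj X'.obj))))).symm) ≪≫
      (asIso (jU.map (τC.εLE.app (jR.obj X'.obj)))) ≪≫ eR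
  -- no maps from objects killed by `j^*`
  have hno : ∀ (Y : THeart C tC) (u : Y ⟶ τC.H₀.obj (jR.obj X'.obj)),
      IsZero (jU.obj Y.obj) → u.hom = 0 := by
    intro Y u hY
    have hYle := aux_isLE Y
    have hiso : IsIso (τC.ηGE.app (τC.truncLE.obj (jR.obj X'.obj))) := by
      apply aux_F_η (𝟭 C) (t' := tC) (fun _ h => h) (fun _ h => h) τC
      obtain ⟨i, hi, hi'⟩ := aux_iso_le τC (jR.obj X'.obj)
      have : tC.IsGE ((tC.truncLT 1).obj (jR.obj X'.obj)) 0 := by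
        refine tC.isGE₂ _
          (inv_rot_of_distTriang _ (tC.triangleLTGE_distinguished 1 (jR.obj X'.obj))) 0 ?_ hjRge
        have h1 : tC.IsGE ((tC.truncGE 1).obj (jR.obj X'.obj)) 1 := inferInstance
        have h2 : tC.IsGE (((tC.truncGE 1).obj (jR.obj X'.obj))⟦(-1 : ℤ)⟧) 2 :=
          tC.isGE_shift _ 1 (-1) 2
        exact tC.isGE_of_ge (((tC.truncGE 1).obj (jR.obj X'.obj))⟦(-1 : ℤ)⟧) 0 2
      exact tC.isGE_of_iso (asIso i) 0
    let u' : Y.obj ⟶ τC.truncGE.obj (τC.truncLE.obj (jR.obj X'.obj)) := u.hom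
    change u' = 0
    have h0 : u' ≫ inv (τC.ηGE.app (τC.truncLE.obj (jR.obj X'.obj))) = 0 := by
      apply (τC.le_univ Y.obj (jR.obj X'.obj) hYle.le).1
      apply (adj₄.homEquiv _ _).symm.injective
      exact hY.eq_of_src _ _
    rw [← cancel_mono (inv (τC.ηGE.app (τC.truncLE.obj (jR.obj X'.obj)))), h0, zero_comp]
  -- no maps to objects killed by `j^*`
  have hno' : ∀ (Z : THeart C tC) (u : τC.H₀.obj (jL.obj X'.obj) ⟶ Z),
      IsZero (jU.obj Z.obj) → u.hom = 0 := by
    intro Z u hZ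
    have hZge := aux_isGE Z
    have hiso : IsIso (τC.εLE.app (jL.obj X'.obj)) :=
      aux_F_ε (𝟭 C) (t' := tC) (fun _ h => h) (fun _ h => h) τC _ hjLle
    let u' : τC.truncGE.obj (τC.truncLE.obj (jL.obj X'.obj)) ⟶ Z.obj := u.hom
    change u' = 0
    apply (τC.ge_univ _ _ hZge.ge).1
    rw [← cancel_epi (inv (τC.εLE.app (jL.obj X'.obj)))]
    apply (adj₃.homEquiv _ _).injective
    exact hZ.eq_of_tgt _ _
  constructor
  intro Y f hf
  let Y' : THeart E tE := ⟨jU.obj Y.obj, hle _ Y.property.1, hge _ Y.property.2⟩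
  let f' : Y' ⟶ X' := ObjectProperty.homMk (jU.map f.hom ≫ eK.hom)
  have hf' : Mono f' := by
    constructor
    intro W a b hab
    ext
    rw [← sub_eq_zero]
    apply aux_map_mono jU hge f (aux_isLE W)
    have h1 : a.hom ≫ jU.map f.hom ≫ eK.hom = b.hom ≫ jU.map f.hom ≫ eK.hom :=
      congrArg (fun q => q.hom) hab
    rw [Preadditive.sub_comp, sub_eq_zero, ← cancel_mono eK.hom]
    simpa using h1
  constructor
  · intro hiso h0
    have h1 : jU.map f.hom = 0 := by
      have : f.hom = 0 := congrArg (fun q => q.hom) h0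
      rw [this, Functor.map_zero]
    have h2 : IsIso f'.hom := by
      have : IsIso f.hom := inferInstance
      exact IsIso.comp_isIso' (inferInstanceAs (IsIso (jU.map f.hom))) inferInstance
    have h3 : IsIso f' := (ObjectProperty.isIso_hom_iff f').1 h2
    refine (Simple.mono_isIso_iff_nonzero f').1 h3 ?_
    ext
    change jU.map f.hom ≫ eK.hom = 0
    rw [h1, zero_comp]
  · intro hne
    by_cases hz : f' = 0
    · exfalso
      apply hne
      have h1 : jU.map f.hom ≫ eK.hom = 0 := congrArg (fun q => q.hom) hz
      have h2 : jU.map f.hom = 0 := by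
        rw [← cancel_mono eK.hom, h1, zero_comp]
      have h3 : IsZero (jU.obj Y.obj) := by
        rw [IsZero.iff_id_eq_zero]
        apply aux_map_mono jU hge f (aux_isLE Y')
        rw [h2, comp_zero]
      rw [← cancel_mono m]
      ext
      have := hno Y (f ≫ m) h3
      rw [this]
      change 0 = (0 : Y.obj ⟶ _) ≫ m.hom
      rw [zero_comp]
    · have h1 : IsIso f' := (Simple.mono_isIso_iff_nonzero f').2 hz
      have h2 : IsIso (jU.map f.hom ≫ eK.hom) := inferInstanceAs (IsIso f'.hom)
      have h3 : IsIso (jU.map f.hom) := IsIso.of_isIso_comp_right _ eK.hom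
      obtain ⟨Z, g, h, hT⟩ := distinguished_cocone_triangle f.hom
      have hZ : IsZero (jU.obj Z) :=
        (Triangle.isZero₃_iff_isIso₁ _ (jU.map_distinguished _ hT)).2 h3
      have hZge := aux_cone_ge f g h hT
      have hYle := aux_isLE Y
      have hY1 : tC.IsLE (Y.obj⟦(1 : ℤ)⟧) (-1) := tC.isLE_shift Y.obj 0 1 (-1)
      have hZle : tC.IsLE Z 0 :=
        tC.isLE₂ _ (rot_of_distTriang _ hT) 0 (aux_isLE (image ψ))
          (tC.isLE_of_le (Y.obj⟦(1 : ℤ)⟧) (-1) 0)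
      let Z' : THeart C tC := ⟨Z, hZle.le, hZge.ge⟩
      have h4 : e.hom ≫ g = 0 := hno' Z' (e ≫ ObjectProperty.homMk g) hZ
      obtain ⟨k, hk⟩ := Triangle.coyoneda_exact₂ _ hT e.hom h4
      let k' : τC.H₀.obj (jL.obj X'.obj) ⟶ Y := ObjectProperty.homMk k
      have hk' : k' ≫ f = e := by
        ext
        exact hk.symm
      let F : MonoFactorisation ψ :=
        { I := Y, m := f ≫ m, m_mono := mono_comp f m, e := k'
          fac := by rw [← Category.assoc, hk', hem] }
      have h5 : image.lift F ≫ f = 𝟙 _ := by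
        rw [← cancel_mono m, Category.assoc, Category.id_comp]
        exact image.lift_fac F
      refine ⟨image.lift F, ?_, h5⟩
      rw [← cancel_mono f, Category.assoc, h5]
      simp
end PaperGluing
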